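/- There exists a compact metric space (X, d) and continuous maps f, g : X → X such that for every x, y ∈ X one has d(f(x),f(y)) ≤ λ·d(x,y) or d(g(x),g(y)) ≤ λ·d(x,y), yet no finite composition (word) in f and g has a fixed point. -/

import Mathlib

/-- The countdown on `{0, …, n}`: it moves `i + 1` to `i`, and `0` to `n` or to `0` according to
whether `r` is true or false. -/
def countdown (n : ℕ) (r : Bool) (i : Fin (n + 1)) : Fin (n + 1) :=
  if (i : ℕ) = 0 then (if r then Fin.last n else 0) else ⟨i - 1, by omega⟩

theorem countdown_val (n : ℕ) (r : Bool) (i : Fin (n + 1)) :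
    (countdown n r i : ℕ) = if (i : ℕ) = 0 then (if r then n else 0) else (i : ℕ) - 1 := by
  unfold countdown
  split_ifs <;> simp

theorem foldr_countdown_dichotomy (n : ℕ) (l : List Bool) (i : Fin (n + 1)) :
    (((l.foldr (countdown n) i : Fin (n + 1)) : ℕ) = i - l.length ∧ ((i : ℕ) = 0 → true ∉ l)) ∨
      n + i + 1 ≤ ((l.foldr (countdown n) i : Fin (n + 1)) : ℕ) + l.length := by
  induction l with
  | nil => simp
  | cons r l ih =>
    simp only [List.foldr_cons, countdown_val, List.length_cons, List.mem_cons]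
    generalize ((l.foldr (countdown n) i : Fin (n + 1)) : ℕ) = v at ih ⊢
    have hi := i.isLt
    cases r <;> grind

theorem foldr_countdown_ne {n : ℕ} {l : List Bool} (hl : true ∈ l) (hn : l.length ≤ n)
    (i : Fin (n + 1)) : l.foldr (countdown n) i ≠ i := by
  intro h
  have hpos := List.length_pos_of_mem hl
  have := foldr_countdown_dichotomy n l i
  rw [h] at this
  grind

/-- The letter `c` resets the countdown exactly on the blocks whose parity matches `c`. -/
def blockMap (c : Bool) (x : ∀ n, Fin (n + 1)) : ∀ n, Fin (n + 1) :=
  fun n => countdown n (c == decide (Even n)) (x n)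

theorem continuous_blockMap (c : Bool) : Continuous (blockMap c) :=
  continuous_pi fun n => continuous_of_discreteTopology.comp (continuous_apply n)

theorem foldr_blockMap_apply (l : List Bool) (x : ∀ n, Fin (n + 1)) (n : ℕ) :
    (l.map blockMap).foldr (· ∘ ·) id x n =
      (l.map (· == decide (Even n))).foldr (countdown n) (x n) := by
  induction l with
  | nil => rfl
  | cons c l ih => simp [blockMap, ih]

theorem foldr_blockMap_ne {l : List Bool} (hl : l ≠ []) (x : ∀ n, Fin (n + 1)) :
    (l.map blockMap).foldr (· ∘ ·) id x ≠ x := by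
  intro h
  obtain ⟨c, hc⟩ := List.exists_mem_of_ne_nil l hl
  obtain ⟨n, hn, hcn⟩ : ∃ n, l.length ≤ n ∧ decide (Even n) = c := by
    cases c
    · exact ⟨2 * l.length + 1, by omega, by simp⟩
    · exact ⟨2 * l.length, by omega, by simp⟩
  refine foldr_countdown_ne (n := n) (l := l.map (· == decide (Even n))) ?_ (by simpa) (x n) ?_
  · exact List.mem_map.2 ⟨c, hc, by simp [hcn]⟩
  · rw [← foldr_blockMap_apply, h]

/-- The level of a pair: the distance of two distinct points `x, y` is `lam ^ level x y`. -/
noncomputable def level (x y : ∀ n, Fin (n + 1)) : ℕ :=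
  PiNat.firstDiff x y ^ 2 - max (x (PiNat.firstDiff x y) : ℕ) (y (PiNat.firstDiff x y))

theorem level_comm (x y : ∀ n, Fin (n + 1)) : level x y = level y x := by
  unfold level
  rw [PiNat.firstDiff_comm x y, max_comm]

theorem level_le_sq (x y : ∀ n, Fin (n + 1)) : level x y ≤ PiNat.firstDiff x y ^ 2 :=
  Nat.sub_le _ _

theorem sq_le_level_of_lt {x y : ∀ n, Fin (n + 1)} {m : ℕ} (h : m < PiNat.firstDiff x y) :
    m ^ 2 ≤ level x y := by
  unfold level
  have hx := (x (PiNat.firstDiff x y)).isLt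
  have hy := (y (PiNat.firstDiff x y)).isLt
  generalize PiNat.firstDiff x y = k at *
  have : m ^ 2 + k ≤ k ^ 2 := by nlinarith
  omega

theorem min_level_le {x y z : ∀ n, Fin (n + 1)} (hxz : x ≠ z) :
    min (level x y) (level y z) ≤ level x z := by
  by_cases h₁ : PiNat.firstDiff x y < PiNat.firstDiff x z
  · exact (min_le_left _ _).trans ((level_le_sq x y).trans (sq_le_level_of_lt h₁))
  by_cases h₂ : PiNat.firstDiff y z < PiNat.firstDiff x z
  · exact (min_le_right _ _).trans ((level_le_sq y z).trans (sq_le_level_of_lt h₂))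
  rcases (not_lt.1 h₁).eq_or_lt with e₁ | l₁
  · rcases (not_lt.1 h₂).eq_or_lt with e₂ | l₂
    · unfold level
      rw [← e₁, ← e₂]
      omega
    · have := PiNat.apply_eq_of_lt_firstDiff l₂
      refine (min_le_left _ _).trans ?_
      unfold level
      rw [← e₁, this]
  · have h := PiNat.apply_eq_of_lt_firstDiff l₁
    rcases (not_lt.1 h₂).eq_or_lt with e₂ | l₂
    · refine (min_le_right _ _).trans ?_
      unfold level
      rw [← e₂, h]
    · exact absurd (h.trans (PiNat.apply_eq_of_lt_firstDiff l₂)) (PiNat.apply_firstDiff_ne hxz)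

theorem level_lt_level_blockMap {x y : ∀ n, Fin (n + 1)} (hxy : x ≠ y) {c : Bool}
    (hc : c ≠ decide (Even (PiNat.firstDiff x y))) (hne : blockMap c x ≠ blockMap c y) :
    level x y < level (blockMap c x) (blockMap c y) := by
  have hd := PiNat.apply_firstDiff_ne hxy
  have hd' := PiNat.apply_firstDiff_ne hne
  have hmax : 0 < max (x (PiNat.firstDiff x y) : ℕ) (y (PiNat.firstDiff x y)) := by
    have := Fin.val_ne_of_ne hd
    omega
  have hx := (x (PiNat.firstDiff x y)).isLt
  have hy := (y (PiNat.firstDiff x y)).isLt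
  have hsq : PiNat.firstDiff x y ≤ PiNat.firstDiff x y ^ 2 := Nat.le_self_pow two_ne_zero _
  have hle : PiNat.firstDiff x y ≤ PiNat.firstDiff (blockMap c x) (blockMap c y) := by
    by_contra! hlt
    exact hd' (by simp only [blockMap, PiNat.apply_eq_of_lt_firstDiff hlt])
  have hlev : level x y < PiNat.firstDiff x y ^ 2 := by
    unfold level
    omega
  rcases hle.eq_or_lt with e | l
  · unfold level
    rw [← e]
    simp only [blockMap, countdown_val, beq_eq_false_iff_ne.2 hc, Bool.false_eq_true, if_false]
    generalize PiNat.firstDiff x y ^ 2 = k at *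
    split_ifs <;> omega
  · exact hlev.trans_le (sq_le_level_of_lt l)

open Classical in
/-- The distance `lam ^ level x y` between distinct points. -/
noncomputable def blockDist (lam : ℝ) (x y : ∀ n, Fin (n + 1)) : ℝ :=
  if x = y then 0 else lam ^ level x y

theorem blockDist_self (lam : ℝ) (x : ∀ n, Fin (n + 1)) : blockDist lam x x = 0 := by
  simp [blockDist]

theorem blockDist_of_ne (lam : ℝ) {x y : ∀ n, Fin (n + 1)} (h : x ≠ y) :
    blockDist lam x y = lam ^ level x y := by
  simp [blockDist, h]

theorem blockDist_comm (lam : ℝ) (x y : ∀ n, Fin (n + 1)) :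
    blockDist lam x y = blockDist lam y x := by
  by_cases h : x = y
  · rw [h]
  · rw [blockDist_of_ne lam h, blockDist_of_ne lam (Ne.symm h), level_comm]

theorem blockDist_nonneg {lam : ℝ} (h0 : 0 < lam) (x y : ∀ n, Fin (n + 1)) : 0 ≤ blockDist lam x y := by
  unfold blockDist
  split_ifs <;> positivity

theorem eq_of_blockDist_eq_zero {lam : ℝ} (h0 : 0 < lam) {x y : ∀ n, Fin (n + 1)} (h : blockDist lam x y = 0) :
    x = y := by
  by_contra hne
  rw [blockDist_of_ne lam hne] at h
  exact (pow_pos h0 _).ne' h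

theorem blockDist_triangle {lam : ℝ} (h0 : 0 < lam) (h1 : lam < 1)
    (x y z : ∀ n, Fin (n + 1)) :
    blockDist lam x z ≤ blockDist lam x y + blockDist lam y z := by
  have hxy := blockDist_nonneg h0 x y
  have hyz := blockDist_nonneg h0 y z
  by_cases h₁ : x = y
  · subst h₁
    linarith
  by_cases h₂ : y = z
  · subst h₂
    linarith
  by_cases h₃ : x = z
  · subst h₃
    rw [blockDist_self]
    positivity
  rw [blockDist_of_ne lam h₁] at *
  rw [blockDist_of_ne lam h₂] at *
  rw [blockDist_of_ne lam h₃]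
  rcases min_le_iff.1 (min_level_le (y := y) h₃) with h | h
  · linarith [pow_le_pow_of_le_one h0.le h1.le h]
  · linarith [pow_le_pow_of_le_one h0.le h1.le h]

theorem isOpen_iff_blockDist {lam : ℝ} (h0 : 0 < lam) (h1 : lam < 1)
    (s : Set (∀ n, Fin (n + 1))) :
    IsOpen s ↔ ∀ x ∈ s, ∃ ε > 0, ∀ y, blockDist lam x y < ε → y ∈ s := by
  rw [(PiNat.isTopologicalBasis_cylinders fun n => Fin (n + 1)).isOpen_iff]
  refine forall₂_congr fun x _ => ⟨?_, ?_⟩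
  · rintro ⟨_, ⟨z, n, rfl⟩, hx, hs⟩
    rw [PiNat.mem_cylinder_iff_eq] at hx
    rw [← hx] at hs
    refine ⟨lam ^ n ^ 2, by positivity, fun y hy => hs ?_⟩
    by_cases hxy : y = x
    · exact hxy ▸ PiNat.self_mem_cylinder _ _
    rw [PiNat.mem_cylinder_iff_le_firstDiff hxy]
    by_contra! hlt
    rw [blockDist_comm, blockDist_of_ne lam hxy] at hy
    refine hy.not_ge (pow_le_pow_of_le_one h0.le h1.le ?_)
    exact (level_le_sq y x).trans (Nat.pow_le_pow_left hlt.le 2)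
  · rintro ⟨ε, hε, hs⟩
    obtain ⟨n, hn⟩ := exists_pow_lt_of_lt_one hε h1
    refine ⟨PiNat.cylinder x (n + 1), ⟨x, n + 1, rfl⟩, PiNat.self_mem_cylinder _ _,
      fun y hy => hs y ?_⟩
    by_cases hxy : y = x
    · rwa [hxy, blockDist_self]
    rw [PiNat.mem_cylinder_iff_le_firstDiff hxy] at hy
    rw [blockDist_comm, blockDist_of_ne lam hxy]
    refine (pow_le_pow_of_le_one h0.le h1.le ?_).trans_lt hn
    exact (Nat.le_self_pow two_ne_zero n).trans (sq_le_level_of_lt hy)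

theorem blockDist_blockMap_le {lam : ℝ} (h0 : 0 < lam) (h1 : lam < 1)
    (x y : ∀ n, Fin (n + 1)) {c : Bool}
    (hc : c ≠ decide (Even (PiNat.firstDiff x y))) :
    blockDist lam (blockMap c x) (blockMap c y) ≤ lam * blockDist lam x y := by
  by_cases hne : blockMap c x = blockMap c y
  · rw [hne, blockDist_self]
    exact mul_nonneg h0.le (blockDist_nonneg h0 x y)
  have hxy : x ≠ y := fun h => hne (congrArg _ h)
  rw [blockDist_of_ne lam hne, blockDist_of_ne lam hxy, ← pow_succ']
  exact pow_le_pow_of_le_one h0.le h1.le (level_lt_level_blockMap hxy hc hne)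

/-- The metric `blockDist`, which induces the product topology. -/
noncomputable abbrev blockMetricSpace {lam : ℝ} (h0 : 0 < lam) (h1 : lam < 1) :
    MetricSpace (∀ n, Fin (n + 1)) :=
  MetricSpace.ofDistTopology (blockDist lam) (blockDist_self lam) (blockDist_comm lam)
    (blockDist_triangle h0 h1) (isOpen_iff_blockDist h0 h1)
    fun _ _ => eq_of_blockDist_eq_zero h0

/-- For every `λ ∈ (0,1)` there is a (nonempty) compact metric space `X` with
continuous maps `f, g : X → X` forming a `λ`-contractive family, such that no
finite composition (word) in `f` and `g` has a fixed point. -/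
theorem stmt_19 (lam : ℝ) (hlam0 : 0 < lam) (hlam1 : lam < 1) :
    ∃ (X : Type) (_ : MetricSpace X) (_ : CompactSpace X) (_ : Nonempty X)
      (f g : X → X),
      Continuous f ∧ Continuous g ∧
      (∀ x y : X, dist (f x) (f y) ≤ lam * dist x y ∨
        dist (g x) (g y) ≤ lam * dist x y) ∧
      ∀ l : List Bool, l ≠ [] →
        ∀ x : X, (l.map (fun c => if c then f else g)).foldr (· ∘ ·) id x ≠ x := by
  refine ⟨∀ n, Fin (n + 1), blockMetricSpace hlam0 hlam1, Pi.compactSpace, ⟨fun _ => 0⟩,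
    blockMap true, blockMap false, continuous_blockMap true, continuous_blockMap false,
    fun x y => ?_, fun l hl x => ?_⟩
  · by_cases h : Even (PiNat.firstDiff x y)
    · exact Or.inr (blockDist_blockMap_le hlam0 hlam1 x y (by simp [h]))
    · exact Or.inl (blockDist_blockMap_le hlam0 hlam1 x y (by simp [h]))
  · have hmap : (fun c : Bool => if c then blockMap true else blockMap false) = blockMap := by
      funext c
      cases c <;> rfl
    rw [hmap]
    exact foldr_blockMap_ne hl x
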